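/- Let θ ≠ 0 be a real number and let c_θ(u,v) = θ(1−e^{−θ})e^{−θ(u+v)} / [1 − e^{−θ} − (1−e^{−θu})(1−e^{−θv})]² be the Frank copula density. Then for all (u,v) ∈ (0,1)², the mixed partial derivative of the logarithm of the density satisfies ∂²/∂u∂v log c_θ(u,v) = 2θ · c_θ(u,v); that is, the Frank density satisfies the hyperbolic Liouville equation with proportionality constant 2θ. -/

import Mathlib

/-- The Frank copula density with parameter `θ ≠ 0`. -/
noncomputable def frankDensity (θ u v : ℝ) : ℝ :=
  θ * (1 - Real.exp (-θ)) * Real.exp (-θ * (u + v)) /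
    (1 - Real.exp (-θ) - (1 - Real.exp (-θ * u)) * (1 - Real.exp (-θ * v))) ^ 2

/-- The denominator of the Frank density, before squaring, does not vanish on the open square. -/
theorem frank_denominator_ne_zero {θ u v : ℝ} (hθ : θ ≠ 0) (hu : u ∈ Set.Ioo (0 : ℝ) 1)
    (hv : v ∈ Set.Ioo (0 : ℝ) 1) :
    1 - Real.exp (-θ) - (1 - Real.exp (-θ * u)) * (1 - Real.exp (-θ * v)) ≠ 0 := by
  obtain ⟨hu0, -⟩ := hu
  obtain ⟨hv0, hv1⟩ := hv
  have hx := Real.exp_pos (-θ * u)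
  rcases lt_or_gt_of_ne hθ with h | h
  · have h1 : 1 < Real.exp (-θ * v) := Real.one_lt_exp_iff.2 (by nlinarith)
    have h2 : Real.exp (-θ * v) < Real.exp (-θ) := Real.exp_lt_exp.2 (by nlinarith)
    nlinarith [mul_pos hx (sub_pos.2 h1)]
  · have h1 : Real.exp (-θ * v) < 1 := Real.exp_lt_one_iff.2 (by nlinarith)
    have h2 : Real.exp (-θ) < Real.exp (-θ * v) := Real.exp_lt_exp.2 (by nlinarith)
    nlinarith [mul_pos hx (sub_pos.2 h1)]

theorem one_sub_exp_neg_ne_zero {θ : ℝ} (hθ : θ ≠ 0) : 1 - Real.exp (-θ) ≠ 0 := by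
  rwa [sub_ne_zero, ne_comm, Ne, Real.exp_eq_one_iff, neg_eq_zero]

theorem hasDerivAt_exp_neg_mul (θ t : ℝ) :
    HasDerivAt (fun s => Real.exp (-θ * s)) (-θ * Real.exp (-θ * t)) t := by
  simpa [mul_comm] using ((hasDerivAt_id t).const_mul (-θ)).exp

/-- The partial derivative of the log-density in its second variable. -/
theorem hasDerivAt_log_frankDensity {θ u v : ℝ} (hθ : θ ≠ 0) (hu : u ∈ Set.Ioo (0 : ℝ) 1)
    (hv : v ∈ Set.Ioo (0 : ℝ) 1) :
    HasDerivAt (fun v' => Real.log (frankDensity θ u v'))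
      (-θ + 2 * θ * Real.exp (-θ * v) * (1 - Real.exp (-θ * u)) /
        (1 - Real.exp (-θ) - (1 - Real.exp (-θ * u)) * (1 - Real.exp (-θ * v)))) v := by
  have hD := frank_denominator_ne_zero hθ hu hv
  have ha := one_sub_exp_neg_ne_zero hθ
  have hnum : HasDerivAt (fun v' => θ * (1 - Real.exp (-θ)) * Real.exp (-θ * (u + v')))
      (θ * (1 - Real.exp (-θ)) * (-θ * Real.exp (-θ * (u + v)))) v :=
    ((hasDerivAt_exp_neg_mul θ (u + v)).comp_const_add u v).const_mul _
  have hden := ((((hasDerivAt_exp_neg_mul θ v).const_sub 1).const_mul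
    (1 - Real.exp (-θ * u))).const_sub (1 - Real.exp (-θ))).pow 2
  have hE := Real.exp_ne_zero (-θ * (u + v))
  have hpos : frankDensity θ u v ≠ 0 :=
    div_ne_zero (mul_ne_zero (mul_ne_zero hθ ha) hE) (pow_ne_zero 2 hD)
  have hlog := (hnum.div hden (pow_ne_zero 2 hD)).log hpos
  refine hlog.congr_deriv ?_
  simp only [Pi.div_apply, Pi.pow_apply]
  generalize Real.exp (-θ * (u + v)) = E at *
  generalize Real.exp (-θ * u) = x at *
  generalize Real.exp (-θ * v) = y at *
  generalize hd : 1 - Real.exp (-θ) - (1 - x) * (1 - y) = D at *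
  generalize 1 - Real.exp (-θ) = b at *
  field_simp
  ring

/-- The Frank copula density satisfies the hyperbolic Liouville equation
`∂²/∂u∂v log c_θ = 2θ · c_θ` on the open unit square. -/
theorem frank_density_satisfies_liouville (θ : ℝ) (hθ : θ ≠ 0) :
    ∀ u ∈ Set.Ioo (0 : ℝ) 1, ∀ v ∈ Set.Ioo (0 : ℝ) 1,
      deriv (fun u' => deriv (fun v' => Real.log (frankDensity θ u' v')) v) u
        = 2 * θ * frankDensity θ u v := by
  intro u hu v hv
  have hD := frank_denominator_ne_zero hθ hu hv
  have heq : (fun u' => deriv (fun v' => Real.log (frankDensity θ u' v')) v) =ᶠ[nhds u]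
      fun u' => -θ + 2 * θ * Real.exp (-θ * v) * (1 - Real.exp (-θ * u')) /
        (1 - Real.exp (-θ) - (1 - Real.exp (-θ * u')) * (1 - Real.exp (-θ * v))) := by
    filter_upwards [isOpen_Ioo.mem_nhds hu] with u' hu'
    exact (hasDerivAt_log_frankDensity hθ hu' hv).deriv
  have hx := (hasDerivAt_exp_neg_mul θ u).const_sub 1
  have hder := ((hx.const_mul (2 * θ * Real.exp (-θ * v))).div
    ((hx.mul_const (1 - Real.exp (-θ * v))).const_sub (1 - Real.exp (-θ))) hD).const_add (-θ)
  rw [heq.deriv_eq]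
  refine hder.deriv.trans ?_
  rw [frankDensity, mul_add, Real.exp_add]
  field_simp
  ring
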